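/- arXiv:2311.07966 — 2 statements merged into one kernel-verified Lean document; each statement's English description precedes it below -/
import Mathlib

section
/- Let G be a connected k-regular finite simple graph on n vertices that is not bipartite, and suppose 0 < λ(G) < k, where λ(G) is the largest absolute value among the eigenvalues μ of the adjacency matrix of G with |μ| < k. Then the diameter of G satisfies diam(G) ≤ 1 + log(2n) / log((k + √(k² − λ(G)²)) / λ(G)). -/
/-- `μ` is an eigenvalue of the (real) adjacency matrix of the graph `G`. -/
def IsAdjEigenvalue {V : Type*} [Fintype V] (G : SimpleGraph V) [DecidableRel G.Adj]
    (μ : ℝ) : Prop :=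
  ∃ x : V → ℝ, x ≠ 0 ∧ (G.adjMatrix ℝ).mulVec x = μ • x

/-- A graph is bipartite if its vertex set splits into two parts with all edges going
between the parts. -/
def IsBipartite {V : Type*} (G : SimpleGraph V) : Prop :=
  ∃ s : Set V, ∀ ⦃u v⦄, G.Adj u v → (u ∈ s ↔ v ∉ s)

open Matrix Polynomial

/-- A left eigenvector of `A` is a left eigenvector of every polynomial in `A`. -/
lemma vecMul_aeval_of_vecMul_eq_smul {ι : Type*} [Fintype ι] [DecidableEq ι]
    {A : Matrix ι ι ℝ} {x : ι → ℝ} {μ : ℝ} (h : x ᵥ* A = μ • x) (p : ℝ[X]) :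
    x ᵥ* aeval A p = p.eval μ • x := by
  have hpow (n : ℕ) : x ᵥ* A ^ n = μ ^ n • x := by
    induction n with
    | zero => simp
    | succ n ih => rw [pow_succ, ← vecMul_vecMul, ih, smul_vecMul, h, smul_smul, pow_succ]
  induction p using Polynomial.induction_on' with
  | add p q hp hq => rw [map_add, vecMul_add, hp, hq, eval_add, add_smul]
  | monomial n a =>
    rw [aeval_monomial, eval_monomial, ← Algebra.smul_def, vecMul_smul, hpow, smul_smul]

/-- If `|p| ≤ 1` at every eigenvalue having an eigenvector not orthogonal to `x`, then the
bilinear form of `p(A)` at `(x, y)` is bounded by `(‖x‖² + ‖y‖²) / 2`. -/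
lemma abs_dotProduct_aeval_mulVec_le {ι : Type*} [Fintype ι] [DecidableEq ι]
    {A : Matrix ι ι ℝ} (hA : A.IsHermitian) (p : ℝ[X]) (x y : ι → ℝ)
    (h : ∀ (μ : ℝ) (b : ι → ℝ), b ≠ 0 → A *ᵥ b = μ • b → x ⬝ᵥ b = 0 ∨ |p.eval μ| ≤ 1) :
    |x ⬝ᵥ (aeval A p *ᵥ y)| ≤ (x ⬝ᵥ x + y ⬝ᵥ y) / 2 := by
  set b := hA.eigenvectorBasis
  have parseval (z w : ι → ℝ) : z ⬝ᵥ w = ∑ i, (z ⬝ᵥ (b i).ofLp) * ((b i).ofLp ⬝ᵥ w) := by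
    have := b.sum_inner_mul_inner (WithLp.toLp 2 z) (WithLp.toLp 2 w)
    simp only [EuclideanSpace.inner_eq_star_dotProduct, star_trivial] at this
    rw [dotProduct_comm z w, ← this]
    exact Finset.sum_congr rfl fun i _ ↦ by
      rw [dotProduct_comm z, dotProduct_comm w]
  have heig (i : ι) : A *ᵥ (b i).ofLp = hA.eigenvalues i • (b i).ofLp :=
    hA.mulVec_eigenvectorBasis i
  have hleft (i : ι) : (b i).ofLp ᵥ* A = hA.eigenvalues i • (b i).ofLp := by
    rw [← mulVec_transpose, ← conjTranspose_eq_transpose_of_trivial, hA.eq, heig]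
  rw [parseval x (aeval A p *ᵥ y), parseval x x, parseval y y, ← Finset.sum_add_distrib,
    Finset.sum_div]
  refine (Finset.abs_sum_le_sum_abs _ _).trans (Finset.sum_le_sum fun i _ ↦ ?_)
  rw [dotProduct_mulVec, vecMul_aeval_of_vecMul_eq_smul (hleft i), smul_dotProduct, smul_eq_mul,
    dotProduct_comm _ x, dotProduct_comm _ y]
  set s := x ⬝ᵥ (b i).ofLp
  set t := y ⬝ᵥ (b i).ofLp
  have hb : (b i).ofLp ≠ 0 := fun h0 ↦
    b.orthonormal.ne_zero i (by ext j; simpa using congrFun h0 j)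
  rcases h _ _ hb (heig i) with h0 | h1
  · have : s = 0 := h0
    rw [this]
    simp only [zero_mul, abs_zero, zero_add]
    exact div_nonneg (mul_self_nonneg t) zero_le_two
  · have h2 : |s * (p.eval (hA.eigenvalues i) * t)| ≤ |s| * |t| := by
      rw [abs_mul, abs_mul]
      exact mul_le_mul_of_nonneg_left
        (mul_le_of_le_one_left (abs_nonneg _) h1) (abs_nonneg _)
    refine h2.trans ?_
    nlinarith [sq_nonneg (|s| - |t|), abs_mul_abs_self s, abs_mul_abs_self t]

namespace SimpleGraph

variable {V : Type*} {G : SimpleGraph V}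

lemma Connected.eq_of_forall_adj_eq {α : Type*} (hG : G.Connected) {f : V → α}
    (h : ∀ u v, G.Adj u v → f u = f v) (u v : V) : f u = f v := by
  obtain ⟨w⟩ := hG.preconnected u v
  induction w with
  | nil => rfl
  | cons huv _ ih => exact (h _ _ huv).trans ih

variable [Fintype V] [DecidableRel G.Adj]

/-- The entries of a polynomial in the adjacency matrix vanish at pairs of vertices whose distance
exceeds the degree. -/
lemma aeval_adjMatrix_apply_eq_zero [DecidableEq V] {p : ℝ[X]} {u v : V}
    (h : p.natDegree < G.dist u v) : aeval (G.adjMatrix ℝ) p u v = 0 := by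
  rw [aeval_eq_sum_range, Matrix.sum_apply]
  refine Finset.sum_eq_zero fun i hi ↦ ?_
  rw [Matrix.smul_apply, adjMatrix_pow_apply_eq_card_walk]
  have : IsEmpty {w : G.Walk u v | w.length = i} := ⟨fun ⟨w, hw⟩ ↦ by
    have := G.dist_le w
    simp only [Set.mem_ofPred_eq] at hw
    have := Finset.mem_range.1 hi
    omega⟩
  simp

/-- The quadratic form of `k + s A` for `s = ±1`, evaluated at an eigenvector of `A`. -/
lemma IsRegularOfDegree.sum_adj_sq_add_mul {k : ℕ} (hreg : G.IsRegularOfDegree k)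
    {x : V → ℝ} {μ s : ℝ} (hs : s ^ 2 = 1) (hx : G.adjMatrix ℝ *ᵥ x = μ • x) :
    ∑ u, ∑ v, (if G.Adj u v then (x u + s * x v) ^ 2 else 0)
      = 2 * (k + s * μ) * ∑ u, x u ^ 2 := by
  have hdeg (u : V) : ∑ v, (if G.Adj u v then (1 : ℝ) else 0) = k := by
    rw [← G.degree_eq_sum_if_adj, hreg u]
  have hmul (u : V) : ∑ v, (if G.Adj u v then x v else 0) = μ * x u := by
    have := congrFun hx u
    simpa [mulVec, dotProduct, adjMatrix_apply] using this
  have hexp (u v : V) : (if G.Adj u v then (x u + s * x v) ^ 2 else 0)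
      = x u ^ 2 * (if G.Adj u v then 1 else 0) + 2 * s * x u * (if G.Adj u v then x v else 0)
        + x v ^ 2 * (if G.Adj v u then 1 else 0) := by
    by_cases h : G.Adj u v
    · simp only [h, h.symm, if_true]
      linear_combination x v ^ 2 * hs
    · simp [h, G.adj_comm v u]
  simp_rw [hexp, Finset.sum_add_distrib]
  rw [Finset.sum_comm (f := fun u v ↦ x v ^ 2 * (if G.Adj v u then (1 : ℝ) else 0))]
  simp_rw [← Finset.mul_sum, hdeg, hmul, ← Finset.sum_add_distrib, Finset.mul_sum]
  exact Finset.sum_congr rfl fun u _ ↦ by ring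

lemma IsRegularOfDegree.add_mul_eigenvalue_nonneg {k : ℕ} (hreg : G.IsRegularOfDegree k)
    {x : V → ℝ} {μ s : ℝ} (hs : s ^ 2 = 1) (hx0 : x ≠ 0) (hx : G.adjMatrix ℝ *ᵥ x = μ • x) :
    0 ≤ k + s * μ := by
  have hsum := hreg.sum_adj_sq_add_mul hs hx
  have h1 : 0 ≤ ∑ u, ∑ v, (if G.Adj u v then (x u + s * x v) ^ 2 else 0) :=
    Finset.sum_nonneg fun u _ ↦ Finset.sum_nonneg fun v _ ↦ by positivity
  obtain ⟨w, hw⟩ := Function.ne_iff.1 hx0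
  have h2 : 0 < ∑ u, x u ^ 2 :=
    Finset.sum_pos' (fun _ _ ↦ sq_nonneg _) ⟨w, Finset.mem_univ _, sq_pos_iff.2 hw⟩
  by_contra! hneg
  nlinarith

lemma IsRegularOfDegree.eq_neg_mul_of_adj {k : ℕ} (hreg : G.IsRegularOfDegree k)
    {x : V → ℝ} {μ s : ℝ} (hs : s ^ 2 = 1) (hx : G.adjMatrix ℝ *ᵥ x = μ • x)
    (hμ : k + s * μ = 0) {u v : V} (huv : G.Adj u v) : x u + s * x v = 0 := by
  have hsum := hreg.sum_adj_sq_add_mul hs hx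
  rw [hμ, mul_zero, zero_mul, Finset.sum_eq_zero_iff_of_nonneg
    fun u _ ↦ Finset.sum_nonneg fun v _ ↦ by positivity] at hsum
  have h1 := hsum u (Finset.mem_univ _)
  rw [Finset.sum_eq_zero_iff_of_nonneg fun v _ ↦ by positivity] at h1
  simpa [huv] using h1 v (Finset.mem_univ _)

/-- In a connected non-bipartite `k`-regular graph, every eigenvector of the adjacency matrix
is constant or has eigenvalue of absolute value less than `k`. -/
lemma IsRegularOfDegree.const_or_abs_eigenvalue_lt {k : ℕ} (hreg : G.IsRegularOfDegree k)
    (hconn : G.Connected) (hnbip : ¬ _root_.IsBipartite G) {x : V → ℝ} {μ : ℝ} (hx0 : x ≠ 0)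
    (hx : G.adjMatrix ℝ *ᵥ x = μ • x) : (∀ u v, x u = x v) ∨ |μ| < k := by
  have h1 := hreg.add_mul_eigenvalue_nonneg (s := 1) (by norm_num) hx0 hx
  have h2 := hreg.add_mul_eigenvalue_nonneg (s := -1) (by norm_num) hx0 hx
  rcases h2.eq_or_lt with h2 | h2
  · left
    refine hconn.eq_of_forall_adj_eq fun u v huv ↦ ?_
    have := hreg.eq_neg_mul_of_adj (s := -1) (by norm_num) hx h2.symm huv
    linarith
  rcases h1.eq_or_lt with h1 | h1
  · have hneg (u v : V) (huv : G.Adj u v) : x u = -x v := by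
      have := hreg.eq_neg_mul_of_adj (s := 1) (by norm_num) hx h1.symm huv
      linarith
    have habs := hconn.eq_of_forall_adj_eq (f := fun u ↦ |x u|)
      fun u v huv ↦ by rw [hneg u v huv, abs_neg]
    obtain ⟨w, hw⟩ := Function.ne_iff.1 hx0
    refine absurd ⟨{u | 0 < x u}, fun u v huv ↦ ?_⟩ hnbip
    have hv : x v ≠ 0 := abs_pos.1 (habs w v ▸ abs_pos.2 hw)
    simp only [Set.mem_ofPred_eq, hneg u v huv, Left.neg_pos_iff, not_lt]
    exact ⟨le_of_lt, fun h ↦ lt_of_le_of_ne h hv⟩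
  · right
    exact abs_lt.2 ⟨by linarith, by linarith⟩

/-- If `p` is bounded by `1` on the nontrivial eigenvalues and the `(u, v)` entry of `p(A)`
vanishes, then `p(k)` is at most the number of vertices. -/
lemma IsRegularOfDegree.eval_le_card {k : ℕ} (hreg : G.IsRegularOfDegree k)
    (hconn : G.Connected) (hnbip : ¬ _root_.IsBipartite G) {p : ℝ[X]}
    (hp : ∀ μ, IsAdjEigenvalue G μ → |μ| < k → |p.eval μ| ≤ 1) {u v : V}
    (huv : p.natDegree < G.dist u v) : p.eval (k : ℝ) ≤ Fintype.card V := by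
  classical
  have : Nonempty V := ⟨u⟩
  set n := (Fintype.card V : ℝ) with hn
  have hnpos : 0 < n := by simp [hn, Fintype.card_pos]
  set A := G.adjMatrix ℝ
  have hA : A.IsHermitian := G.isHermitian_adjMatrix ℝ
  have hone : (1 : V → ℝ) ᵥ* A = (k : ℝ) • (1 : V → ℝ) := by
    ext w
    simp [A, hreg w]
  set f : V → ℝ := Pi.single u 1 - n⁻¹ • 1 with hf
  have hform : f ⬝ᵥ (aeval A p *ᵥ Pi.single v 1) = -(n⁻¹ * p.eval (k : ℝ)) := by
    rw [dotProduct_mulVec, hf, sub_vecMul, smul_vecMul, vecMul_aeval_of_vecMul_eq_smul hone,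
      dotProduct_single]
    simp [A, aeval_adjMatrix_apply_eq_zero huv]
  have hff : f ⬝ᵥ f ≤ 1 := by
    have : f ⬝ᵥ f = 1 - n⁻¹ := by
      simp only [hf, sub_dotProduct, dotProduct_sub, smul_dotProduct, dotProduct_smul,
        single_dotProduct, dotProduct_single, Pi.sub_apply, Pi.smul_apply,
        Pi.single_eq_same, Pi.one_apply, one_dotProduct_one, smul_eq_mul, ← hn]
      field_simp
      ring
    rw [this]
    linarith [inv_pos.2 hnpos]
  have key := abs_dotProduct_aeval_mulVec_le hA p f (Pi.single v 1) fun μ b hb0 hb ↦ by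
    rcases hreg.const_or_abs_eigenvalue_lt hconn hnbip hb0 hb with hc | hlt
    · left
      have : b = b u • 1 := by ext w; simp [hc w u]
      rw [this, hf, dotProduct_smul, sub_dotProduct, smul_dotProduct, one_dotProduct_one,
        single_dotProduct, ← hn]
      simp [hnpos.ne']
    · exact Or.inr (hp μ ⟨b, hb0, hb⟩ hlt)
  rw [hform, abs_neg] at key
  have h1 : n⁻¹ * p.eval (k : ℝ) ≤ 1 := by
    refine (le_abs_self _).trans (key.trans ?_)
    simp only [single_dotProduct, Pi.single_eq_same]
    linarith
  rwa [inv_mul_le_iff₀ hnpos, mul_one] at h1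

end SimpleGraph

/-- Chung's diameter bound for connected non-bipartite `k`-regular graphs:
`diam(G) ≤ 1 + log(2n) / log((k + √(k² − λ²)) / λ)`. -/
theorem chung_diameter_bound_nonbipartite {V : Type*} [Fintype V]
    (G : SimpleGraph V) [DecidableRel G.Adj] (k : ℕ)
    (hconn : G.Connected) (hreg : G.IsRegularOfDegree k) (hnbip : ¬ IsBipartite G)
    (lam : ℝ)
    (hlam : IsGreatest {x : ℝ | ∃ μ : ℝ, IsAdjEigenvalue G μ ∧ |μ| < k ∧ x = |μ|} lam)
    (hpos : 0 < lam) (hlt : lam < k) :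
    (G.diam : ℝ) ≤ 1 + Real.log (2 * Fintype.card V) /
      Real.log ((k + Real.sqrt (k ^ 2 - lam ^ 2)) / lam) := by
  obtain ⟨w⟩ := hconn.nonempty
  have hk : 1 < k / lam := (one_lt_div hpos).2 hlt
  have hlog : Real.log ((k + Real.sqrt (k ^ 2 - lam ^ 2)) / lam) = Real.arcosh (k / lam) := by
    have h : (k / lam) ^ 2 - 1 = (k ^ 2 - lam ^ 2) / lam ^ 2 := by field_simp
    rw [Real.arcosh, h, Real.sqrt_div' _ (sq_nonneg lam), Real.sqrt_sq hpos.le, add_div]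
  have hθ := Real.arcosh_pos hk
  have hcard : (1 : ℝ) ≤ Fintype.card V := by
    exact_mod_cast Fintype.card_pos_iff.2 ⟨w⟩
  rw [hlog, ← sub_le_iff_le_add', le_div_iff₀ hθ]
  have : Nonempty V := ⟨w⟩
  obtain ⟨u, v, huv⟩ := G.exists_dist_eq_diam
  obtain hd | ⟨m, hm⟩ : G.diam = 0 ∨ ∃ m, G.diam = m + 1 :=
    (Nat.eq_zero_or_eq_succ_pred _).imp_right fun h ↦ ⟨_, h⟩
  · have := Real.log_nonneg (x := 2 * Fintype.card V) (by linarith)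
    rw [hd]
    push_cast
    linarith
  set p : ℝ[X] := (Chebyshev.T ℝ m).comp (C lam⁻¹ * X) with hp
  have hdeg : p.natDegree < G.dist u v := by
    rw [hp, natDegree_comp, natDegree_C_mul_X _ (inv_ne_zero hpos.ne'), Chebyshev.natDegree_T, huv,
      hm]
    simp
  have heval (μ : ℝ) : p.eval μ = (Chebyshev.T ℝ m).eval (μ / lam) := by
    simp [hp, div_eq_inv_mul]
  have hle := hreg.eval_le_card hconn hnbip (p := p) (fun μ hμ hμk ↦ by
    rw [heval]
    refine Chebyshev.abs_eval_T_real_le_one _ ?_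
    rw [abs_div, abs_of_pos hpos, div_le_one hpos]
    exact hlam.2 ⟨μ, hμ, hμk, rfl⟩) hdeg
  rw [heval, ← Real.cosh_arcosh hk.le, Chebyshev.T_real_cosh, Real.cosh_eq] at hle
  rw [hm, Real.le_log_iff_exp_le (by linarith)]
  push_cast at hle ⊢
  rw [add_sub_cancel_right]
  linarith [Real.exp_pos (-(m * Real.arcosh (k / lam)))]
end

section
/- Let G be a connected k-regular finite simple graph (k ≥ 1). Then G is bipartite if and only if −k is an eigenvalue of the adjacency matrix of G. -/
/-- If the neighbours of `v` sum to `-(degree v) * x v` and `|x|` is maximal at `v`, then `x` takes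
the value `-x v` at every neighbour of `v`. -/
theorem SimpleGraph.eq_neg_of_sum_neighborFinset_eq {V : Type*} [Fintype V] (G : SimpleGraph V)
    [DecidableRel G.Adj] {x : V → ℝ} {v : V} (hmax : ∀ w, |x w| ≤ |x v|) (hne : x v ≠ 0)
    (hsum : ∑ w ∈ G.neighborFinset v, x w = -(G.degree v : ℝ) * x v) {w : V} (hvw : G.Adj v w) :
    x w = -x v := by
  have hnonneg : ∀ u ∈ G.neighborFinset v, 0 ≤ x v * (x v + x u) := fun u _ => by
    have h : |x v * x u| ≤ x v * x v := by
      rw [abs_mul, ← abs_mul_abs_self (x v)]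
      exact mul_le_mul_of_nonneg_left (hmax u) (abs_nonneg _)
    linarith [neg_abs_le (x v * x u)]
  have hzero : ∑ u ∈ G.neighborFinset v, x v * (x v + x u) = 0 := by
    rw [← Finset.mul_sum, Finset.sum_add_distrib, hsum]
    simp
  have h := (Finset.sum_eq_zero_iff_of_nonneg hnonneg).1 hzero w (by simpa using hvw)
  linarith [(mul_eq_zero.1 h).resolve_left hne]

/-- A connected `k`-regular graph (`k ≥ 1`) is bipartite if and only if `−k` is an
eigenvalue of its adjacency matrix. -/
theorem bipartite_iff_neg_k_eigenvalue {V : Type*} [Fintype V]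
    (G : SimpleGraph V) [DecidableRel G.Adj] (k : ℕ) (hk : 1 ≤ k)
    (hconn : G.Connected) (hreg : G.IsRegularOfDegree k) :
    IsBipartite G ↔ IsAdjEigenvalue G (-(k : ℝ)) := by
  classical
  constructor
  · rintro ⟨s, hs⟩
    refine ⟨fun v => if v ∈ s then 1 else -1, ?_, ?_⟩
    · obtain ⟨v⟩ := hconn.nonempty
      refine fun h => ?_
      have hv := congrFun h v
      by_cases hvs : v ∈ s <;> simp [hvs] at hv
    · funext v
      rw [SimpleGraph.adjMatrix_mulVec_apply]
      have hneighbor : ∀ w ∈ G.neighborFinset v,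
          (if w ∈ s then (1 : ℝ) else -1) = -(if v ∈ s then 1 else -1) := fun w hw => by
        have hvw := hs ((G.mem_neighborFinset v w).1 hw)
        by_cases hws : w ∈ s <;> simp [hvw, hws]
      rw [Finset.sum_congr rfl hneighbor]
      by_cases hvs : v ∈ s <;> simp [hreg v, hvs]
  · rintro ⟨x, hx, hAx⟩
    have hsum : ∀ v, ∑ w ∈ G.neighborFinset v, x w = -(G.degree v : ℝ) * x v := fun v => by
      rw [← SimpleGraph.adjMatrix_mulVec_apply, hAx, hreg v, Pi.smul_apply, smul_eq_mul]
    obtain ⟨u, hu⟩ := Function.ne_iff.1 hx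
    have := hconn.nonempty
    obtain ⟨a, ha⟩ := Finite.exists_max fun v => |x v|
    have hpos : 0 < |x a| := (abs_pos.2 hu).trans_le (ha u)
    have hadj : ∀ {v w}, |x v| = |x a| → G.Adj v w → x w = -x v := fun hv hvw =>
      G.eq_neg_of_sum_neighborFinset_eq (fun w => hv ▸ ha w) (abs_pos.1 (hv ▸ hpos)) (hsum _) hvw
    have habs : ∀ v, |x v| = |x a| := fun v => by
      have hav := (SimpleGraph.reachable_iff_reflTransGen a v).1 (hconn.preconnected a v)
      induction hav with
      | refl => rfl
      | tail _ hvw ih => rw [hadj ih hvw, abs_neg, ih]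
    refine ⟨{v | 0 < x v}, fun v w hvw => ?_⟩
    have hne : x v ≠ 0 := abs_pos.1 (habs v ▸ hpos)
    simp only [Set.mem_ofPred_eq, hadj (habs v) hvw, not_lt, Left.neg_pos_iff]
    exact ⟨le_of_lt, fun h => h.lt_of_ne' hne⟩
end
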